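/- Let 0 < σ < 1 and α, β ≥ −1/2. Suppose the exponents p, q satisfy max{(2α+2)/(α+3/2), (2β+2)/(β+3/2)} < p ≤ q < min{(2α+2)/(α+1/2), (2β+2)/(β+1/2)} and 1/q ≥ 1/p − min{σ/(2α+2), σ/(2β+2)}. With w(θ) = (sin(θ/2))^{(2α+1)(1−q/2)} (cos(θ/2))^{(2β+1)(1−q/2)} and v(θ) = (sin(θ/2))^{(2α+1)(1−p/2)} (cos(θ/2))^{(2β+1)(1−p/2)}, there exists a constant C, depending only on σ, α, β, p and q, such that for all sequences (g_j)_{j≥0} of nonnegative measurable functions on (0,π): ‖ (Σ_{j=0}^∞ (I_σ g_j)² )^{1/2} ‖_{L^q((0,π), w dθ)} ≤ C ‖ (Σ_{j=0}^∞ g_j² )^{1/2} ‖_{L^p((0,π), v dθ)}. -/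

import Mathlib

open MeasureTheory Real Set

/-- The fractional integral `I_σ g(θ) = ∫_0^π g(φ)/|θ-φ|^{1-σ} dφ` of a nonnegative
function on `(0,π)`, with values in `[0,∞]`. -/
noncomputable def fracIntegral (σ : ℝ) (g : ℝ → ℝ) (θ : ℝ) : ENNReal :=
  ∫⁻ φ in Ioo (0:ℝ) π, ENNReal.ofReal (g φ) * ENNReal.ofReal |θ - φ| ^ (σ - 1)


/-- Schur/Young test from `L^p` to `L^q`. -/
theorem fi_schur {X : Type*} [MeasurableSpace X] (μ : Measure X) [SFinite μ]
    (K : X → X → ENNReal) (hK : Measurable (Function.uncurry K)) (f : X → ENNReal)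
    (hf : Measurable f) (p q r : ℝ) (hp : 1 < p) (hpq : p ≤ q) (hr : 0 < r)
    (hrpq : 1 / r = 1 - 1/p + 1/q) (M : ENNReal)
    (h1 : ∀ᵐ x ∂μ, ∫⁻ y, K x y ^ r ∂μ ≤ M) (h2 : ∀ᵐ y ∂μ, ∫⁻ x, K x y ^ r ∂μ ≤ M) :
    (∫⁻ x, (∫⁻ y, K x y * f y ∂μ) ^ q ∂μ) ^ (1/q) ≤
      M ^ (1/r) * (∫⁻ y, f y ^ p ∂μ) ^ (1/p) := by
  have hp0 : 0 < p := by linarith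
  have hq0 : 0 < q := by linarith
  have e1 : 0 ≤ 1 - 1/p := by
    have : 1/p < 1 := by rw [div_lt_one hp0]; exact hp
    linarith
  have e2 : 0 ≤ 1/p - 1/q := by
    have := one_div_le_one_div_of_le hp0 hpq
    linarith
  have e3 : 0 ≤ 1/q := by positivity
  set N := ∫⁻ y, f y ^ p ∂μ with hN
  have hKx : ∀ x, Measurable (K x) := fun x => hK.of_uncurry_left
  have step : ∀ x, ∫⁻ y, K x y * f y ∂μ ≤
      (∫⁻ y, K x y ^ r * f y ^ p ∂μ) ^ (1/q) * (∫⁻ y, K x y ^ r ∂μ) ^ (1 - 1/p) *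
        N ^ (1/p - 1/q) := by
    intro x
    have := ENNReal.lintegral_prod_norm_pow_le (μ := μ) (Finset.univ : Finset (Fin 3))
      (f := ![fun y => K x y ^ r * f y ^ p, fun y => K x y ^ r, fun y => f y ^ p])
      (p := ![1/q, 1 - 1/p, 1/p - 1/q])
      (by
        intro i _
        fin_cases i
        · exact (((hKx x).pow_const r).mul (hf.pow_const p)).aemeasurable
        · exact ((hKx x).pow_const r).aemeasurable
        · exact (hf.pow_const p).aemeasurable)
      (by rw [Fin.sum_univ_three]; simp; ring)
      (by
        intro i _
        fin_cases i
        · exact e3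
        · exact e1
        · exact e2)
    simp only [Fin.prod_univ_three] at this
    refine le_trans (le_of_eq ?_) this
    refine lintegral_congr fun y => ?_
    change _ = (K x y ^ r * f y ^ p) ^ (1/q) * (K x y ^ r) ^ (1 - 1/p) * (f y ^ p) ^ (1/p - 1/q)
    rw [ENNReal.mul_rpow_of_nonneg _ _ e3, ← ENNReal.rpow_mul, ← ENNReal.rpow_mul,
      ← ENNReal.rpow_mul, ← ENNReal.rpow_mul]
    calc K x y * f y = K x y ^ (r * (1/q) + r * (1 - 1/p)) *
          f y ^ (p * (1/q) + p * (1/p-1/q)) := by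
            have a1 : r * (1/q) + r * (1 - 1/p) = 1 := by
              rw [← mul_add, show 1/q + (1 - 1/p) = 1/r by linarith]
              field_simp
            have a2 : p * (1/q) + p * (1/p-1/q) = 1 := by
              field_simp; ring
            rw [a1, a2, ENNReal.rpow_one, ENNReal.rpow_one]
      _ = _ := by
        rw [ENNReal.rpow_add_of_nonneg _ _ (by positivity) (by positivity),
          ENNReal.rpow_add_of_nonneg _ _ (by positivity) (by positivity)]
        ring
  have step2 : ∫⁻ x, (∫⁻ y, K x y * f y ∂μ) ^ q ∂μ ≤
      (M ^ (1 - 1/p) * N ^ (1/p - 1/q)) ^ q * (M * N) := by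
    calc ∫⁻ x, (∫⁻ y, K x y * f y ∂μ) ^ q ∂μ
        ≤ ∫⁻ x, (M ^ (1 - 1/p) * N ^ (1/p - 1/q)) ^ q * ∫⁻ y, K x y ^ r * f y ^ p ∂μ ∂μ := by
          refine lintegral_mono_ae ?_
          filter_upwards [h1] with x hx
          calc (∫⁻ y, K x y * f y ∂μ) ^ q ≤ ((∫⁻ y, K x y ^ r * f y ^ p ∂μ) ^ (1/q) *
                M ^ (1 - 1/p) * N ^ (1/p - 1/q)) ^ q := by
                refine ENNReal.rpow_le_rpow ((step x).trans ?_) hq0.le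
                gcongr
            _ = _ := by
                rw [mul_assoc, ENNReal.mul_rpow_of_nonneg _ _ hq0.le, ← ENNReal.rpow_mul,
                  one_div_mul_cancel hq0.ne', ENNReal.rpow_one, mul_comm]
      _ = (M ^ (1 - 1/p) * N ^ (1/p - 1/q)) ^ q * ∫⁻ x, ∫⁻ y, K x y ^ r * f y ^ p ∂μ ∂μ := by
          rw [lintegral_const_mul]
          exact Measurable.lintegral_prod_right'
            (f := fun z : X × X => K z.1 z.2 ^ r * f z.2 ^ p)
            ((hK.pow_const r).mul ((hf.comp measurable_snd).pow_const p))
      _ ≤ _ := by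
          gcongr
          rw [lintegral_lintegral_swap ((hK.pow_const r).mul
            ((hf.comp measurable_snd).pow_const p)).aemeasurable]
          calc ∫⁻ y, ∫⁻ x, K x y ^ r * f y ^ p ∂μ ∂μ ≤ ∫⁻ y, M * f y ^ p ∂μ := by
                refine lintegral_mono_ae ?_
                filter_upwards [h2] with y hy
                rw [lintegral_mul_const _ ((hK.of_uncurry_right).pow_const r)]
                gcongr
            _ = M * N := by rw [lintegral_const_mul _ (hf.pow_const p)]
  calc _ ≤ ((M ^ (1 - 1/p) * N ^ (1/p - 1/q)) ^ q * (M * N)) ^ (1/q) :=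
        ENNReal.rpow_le_rpow step2 e3
    _ = _ := by
      rw [ENNReal.mul_rpow_of_nonneg _ _ e3, ← ENNReal.rpow_mul, mul_one_div_cancel hq0.ne',
        ENNReal.rpow_one, ENNReal.mul_rpow_of_nonneg _ _ e3, hrpq,
        ENNReal.rpow_add_of_nonneg _ _ e1 e3]
      have : N ^ (1/p) = N ^ (1/p - 1/q) * N ^ (1/q) := by
        rw [← ENNReal.rpow_add_of_nonneg _ _ e2 e3]; congr 1; ring
      rw [this]; ring

/-- Minkowski's integral inequality for `ℓ²`. -/
theorem fi_minkowski {X : Type*} [MeasurableSpace X] (μ : Measure X)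
    (k : X → ENNReal) (hk : Measurable k) (g : ℕ → X → ENNReal) (hg : ∀ j, Measurable (g j)) :
    ∑' j, (∫⁻ y, g j y * k y ∂μ) ^ (2:ℝ) ≤
      (∫⁻ y, (∑' j, g j y ^ (2:ℝ)) ^ (1/2 : ℝ) * k y ∂μ) ^ (2:ℝ) := by
  set I := ∫⁻ y, (∑' j, g j y ^ (2:ℝ)) ^ (1/2 : ℝ) * k y ∂μ with hI
  set a : ℕ → ENNReal := fun j => ∫⁻ y, g j y * k y ∂μ with ha
  have haI : ∀ j, a j ≤ I := by
    intro j
    refine lintegral_mono fun y => ?_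
    dsimp only
    gcongr
    calc g j y = (g j y ^ (2:ℝ)) ^ (1/2:ℝ) := by
          rw [← ENNReal.rpow_mul]; norm_num
      _ ≤ _ := by
        gcongr
        exact ENNReal.le_tsum (f := fun j => g j y ^ (2:ℝ)) j
  change ∑' j, a j ^ (2:ℝ) ≤ I ^ (2:ℝ)
  by_cases hItop : I = ⊤
  · rw [hItop]; simp
  rw [ENNReal.tsum_eq_iSup_sum]
  refine iSup_le fun s => ?_
  set A := ∑ j ∈ s, a j ^ (2:ℝ) with hA
  have hAtop : A ≠ ⊤ := by
    refine ENNReal.sum_ne_top.2 fun j _ => ?_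
    exact ENNReal.rpow_ne_top_of_nonneg (by norm_num) (ne_top_of_le_ne_top hItop (haI j))
  have key : A ≤ A ^ (1/2:ℝ) * I := by
    calc A = ∑ j ∈ s, ∫⁻ y, a j * (g j y * k y) ∂μ := by
          refine Finset.sum_congr rfl fun j _ => ?_
          have hm : Measurable fun y => g j y * k y := (hg j).mul hk
          rw [lintegral_const_mul _ hm, ENNReal.rpow_two, sq]
      _ = ∫⁻ y, ∑ j ∈ s, a j * (g j y * k y) ∂μ := by
          have hm : ∀ j, Measurable fun y => a j * (g j y * k y) :=
            fun j => ((hg j).mul hk).const_mul _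
          rw [lintegral_finsetSum _ (fun j _ => hm j)]
      _ ≤ ∫⁻ y, A ^ (1/2:ℝ) * ((∑' j, g j y ^ (2:ℝ)) ^ (1/2 : ℝ) * k y) ∂μ := by
          refine lintegral_mono fun y => ?_
          calc ∑ j ∈ s, a j * (g j y * k y) = (∑ j ∈ s, a j * g j y) * k y := by
                rw [Finset.sum_mul]; simp only [mul_assoc]
            _ ≤ (A ^ (1/2:ℝ) * (∑ j ∈ s, g j y ^ (2:ℝ)) ^ (1/2:ℝ)) * k y := by
                gcongr
                exact ENNReal.inner_le_Lp_mul_Lq s a (fun j => g j y) Real.HolderConjugate.two_two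
            _ ≤ (A ^ (1/2:ℝ) * (∑' j, g j y ^ (2:ℝ)) ^ (1/2:ℝ)) * k y := by
                gcongr
                exact ENNReal.sum_le_tsum s
            _ = _ := by ring
      _ = A ^ (1/2:ℝ) * I := by
          rw [lintegral_const_mul]
          exact ((Measurable.tsum fun j => (hg j).pow_const _).pow_const _).mul hk
  by_cases hA0 : A = 0
  · rw [hA0]; simp
  have hsq : A = A ^ (1/2:ℝ) * A ^ (1/2:ℝ) := by
    rw [← ENNReal.rpow_add _ _ hA0 hAtop]; norm_num
  have hh0 : A ^ (1/2:ℝ) ≠ 0 := by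
    intro h; rw [h] at hsq; simp at hsq; exact hA0 hsq
  have hht : A ^ (1/2:ℝ) ≠ ⊤ := ENNReal.rpow_ne_top_of_nonneg (by norm_num) hAtop
  have : A ^ (1/2:ℝ) ≤ I := by
    rw [hsq] at key
    have k2 : A ^ (1/2:ℝ) * A ^ (1/2:ℝ) ≤ A ^ (1/2:ℝ) * I := by
      rw [← hsq] at key; rw [← hsq]; exact key
    exact (ENNReal.mul_le_mul_iff_right hh0 hht).1 k2
  calc A = (A ^ (1/2:ℝ)) ^ (2:ℝ) := by rw [← ENNReal.rpow_mul]; norm_num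
    _ ≤ _ := by gcongr

theorem fi_int_one (s d : ℝ) (hs0 : 0 < s) (hs1 : s < 1) (hd : 0 < d) (hds : d < s) :
    ∫⁻ u in Ioi (0:ℝ), ENNReal.ofReal |1 - u| ^ (-s) * ENNReal.ofReal u ^ (d - 1) < ⊤ := by
  have cover : Ioi (0:ℝ) ⊆ (Ioc 0 (1/2) ∪ Ioc (1/2) 1) ∪ (Ioc 1 2 ∪ Ioi 2) := by
    intro u hu
    simp only [mem_Ioi, mem_union, mem_Ioc] at *
    by_cases h1 : u ≤ 1/2
    · left; left; exact ⟨hu, h1⟩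
    by_cases h2 : u ≤ 1
    · left; right; exact ⟨by linarith, h2⟩
    by_cases h3 : u ≤ 2
    · right; left; exact ⟨by linarith, h3⟩
    · right; right; linarith
  set F : ℝ → ENNReal := fun u => ENNReal.ofReal |1 - u| ^ (-s) * ENNReal.ofReal u ^ (d - 1)
  have main : ∀ (A : Set ℝ) (hA : MeasurableSet A) (C : ℝ) (h : ℝ → ℝ), IntegrableOn h A →
      (∀ᵐ u, u ∈ A → F u ≤ ENNReal.ofReal (C * h u)) → ∫⁻ u in A, F u < ⊤ := by
    intro A hA C h hint hle
    refine lt_of_le_of_lt (lintegral_mono_ae ((ae_restrict_iff' hA).2 hle)) ?_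
    exact (hint.const_mul C).lintegral_lt_top
  have hF : ∀ u, 0 < u → u ≠ 1 → F u = ENNReal.ofReal (|1-u| ^ (-s) * u ^ (d-1)) := by
    intro u hu hu1
    have : 0 < |1 - u| := abs_pos.2 (sub_ne_zero.2 hu1.symm)
    simp only [F]
    rw [ENNReal.ofReal_rpow_of_pos this, ENNReal.ofReal_rpow_of_pos hu,
      ENNReal.ofReal_mul (by positivity)]
  have ne1 : ∀ᵐ u : ℝ, u ≠ 1 := by
    simp [ae_iff, measure_singleton]
  refine lt_of_le_of_lt (lintegral_mono_set cover) ?_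
  refine lt_of_le_of_lt (lintegral_union_le _ _ _) (ENNReal.add_lt_top.2 ⟨?_, ?_⟩)
  · refine lt_of_le_of_lt (lintegral_union_le _ _ _) (ENNReal.add_lt_top.2 ⟨?_, ?_⟩)
    · refine main _ measurableSet_Ioc ((1/2) ^ (-s)) (fun u => u ^ (d-1)) ?_ ?_
      · exact (intervalIntegrable_iff_integrableOn_Ioc_of_le (by norm_num)).1
          (intervalIntegral.intervalIntegrable_rpow' (by linarith))
      · filter_upwards [ne1] with u hu1 hu
        rw [hF u hu.1 hu1]
        have hu0 := hu.1
        refine ENNReal.ofReal_le_ofReal (mul_le_mul_of_nonneg_right ?_ (by positivity))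
        refine Real.rpow_le_rpow_of_nonpos (by norm_num) ?_ (by linarith)
        rw [le_abs]; left; linarith [hu.2]
    · refine main _ measurableSet_Ioc ((1/2) ^ (d-1)) (fun u => (1-u) ^ (-s)) ?_ ?_
      · have := (intervalIntegral.intervalIntegrable_rpow' (a := 1/2) (b := 0) (r := -s)
          (by linarith)).comp_sub_left 1
        refine (intervalIntegrable_iff_integrableOn_Ioc_of_le (by norm_num)).1 ?_
        convert this using 1 <;> norm_num
      · filter_upwards [ne1] with u hu1 hu
        have hu0 : 0 < u := by linarith [hu.1]
        rw [hF u hu0 hu1, abs_of_nonneg (by linarith [hu.2]), mul_comm]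
        refine ENNReal.ofReal_le_ofReal (mul_le_mul_of_nonneg_right ?_
          (Real.rpow_nonneg (by linarith [hu.2]) _))
        exact Real.rpow_le_rpow_of_nonpos (by norm_num) hu.1.le (by linarith)
  · refine lt_of_le_of_lt (lintegral_union_le _ _ _) (ENNReal.add_lt_top.2 ⟨?_, ?_⟩)
    · refine main _ measurableSet_Ioc (1 ^ (d-1)) (fun u => (u-1) ^ (-s)) ?_ ?_
      · have := (intervalIntegral.intervalIntegrable_rpow' (a := 0) (b := 1) (r := -s)
          (by linarith)).comp_sub_right 1
        refine (intervalIntegrable_iff_integrableOn_Ioc_of_le (by norm_num)).1 ?_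
        convert this using 1 <;> norm_num
      · filter_upwards [ne1] with u hu1 hu
        have hu0 : 0 < u := by linarith [hu.1]
        rw [hF u hu0 hu1, abs_sub_comm, abs_of_nonneg (by linarith [hu.1]), mul_comm]
        refine ENNReal.ofReal_le_ofReal (mul_le_mul_of_nonneg_right ?_
          (Real.rpow_nonneg (by linarith [hu.1]) _))
        exact Real.rpow_le_rpow_of_nonpos (by norm_num) hu.1.le (by linarith)
    · refine main _ measurableSet_Ioi ((1/2) ^ (-s)) (fun u => u ^ (d-1-s)) ?_ ?_
      · exact integrableOn_Ioi_rpow_of_lt (by linarith) (by norm_num)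
      · filter_upwards [ne1] with u hu1 hu
        have hu2 : 2 < u := hu
        have hu0 : 0 < u := by linarith
        rw [hF u hu0 hu1]
        refine ENNReal.ofReal_le_ofReal ?_
        calc |1-u| ^ (-s) * u ^ (d-1) ≤ ((1/2) * u) ^ (-s) * u ^ (d-1) := by
              refine mul_le_mul_of_nonneg_right ?_ (by positivity)
              refine Real.rpow_le_rpow_of_nonpos (by linarith) ?_ (by linarith)
              rw [le_abs]; right; linarith
          _ = _ := by
              rw [Real.mul_rpow (by norm_num) hu0.le, mul_assoc, ← Real.rpow_add hu0]
              congr 2; ring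

theorem fi_int_scale (s d : ℝ) (hs0 : 0 < s) (x : ℝ) (hx : 0 < x) :
    ∫⁻ y in Ioi (0:ℝ), ENNReal.ofReal |x - y| ^ (-s) * ENNReal.ofReal y ^ (d - 1) =
      ENNReal.ofReal x ^ (d - s) *
      ∫⁻ u in Ioi (0:ℝ), ENNReal.ofReal |1 - u| ^ (-s) * ENNReal.ofReal u ^ (d - 1) := by
  have hx0 : ENNReal.ofReal x ≠ 0 := by simpa using hx
  set F : ℝ → ENNReal := fun y => (Ioi (0:ℝ)).indicator
    (fun y => ENNReal.ofReal |x - y| ^ (-s) * ENNReal.ofReal y ^ (d - 1)) y with hF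
  have hFm : Measurable F := by
    refine Measurable.indicator ?_ measurableSet_Ioi
    fun_prop
  rw [← lintegral_indicator measurableSet_Ioi, ← lintegral_indicator measurableSet_Ioi]
  change ∫⁻ y, F y = _
  rw [← lintegral_const_mul' _ _ (ENNReal.rpow_ne_top_of_ne_zero hx0 ENNReal.ofReal_ne_top)]
  have := Real.smul_map_volume_mul_left hx.ne'
  calc ∫⁻ y, F y = ∫⁻ y, F y ∂(ENNReal.ofReal |x| • Measure.map (x * ·) volume) := by rw [this]
    _ = ENNReal.ofReal x * ∫⁻ u, F (x * u) := by
      rw [lintegral_smul_measure, lintegral_map hFm (by fun_prop), abs_of_pos hx, smul_eq_mul]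
    _ = ∫⁻ u, ENNReal.ofReal x * F (x * u) := by
      rw [lintegral_const_mul _ (by fun_prop)]
    _ = _ := by
      refine lintegral_congr fun u => ?_
      by_cases hu : 0 < u
      · have hxu : x * u ∈ Ioi (0:ℝ) := mul_pos hx hu
        have hu' : u ∈ Ioi (0:ℝ) := hu
        simp only [hF]
        rw [indicator_of_mem hxu, indicator_of_mem hu']
        have : |x - x * u| = x * |1 - u| := by
          rw [show x - x * u = x * (1 - u) by ring, abs_mul, abs_of_pos hx]
        rw [this, ENNReal.ofReal_mul hx.le, ENNReal.ofReal_mul hx.le,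
          ENNReal.mul_rpow_of_ne_top ENNReal.ofReal_ne_top ENNReal.ofReal_ne_top,
          ENNReal.mul_rpow_of_ne_top ENNReal.ofReal_ne_top ENNReal.ofReal_ne_top]
        have e : ENNReal.ofReal x ^ (d - s) = ENNReal.ofReal x * ENNReal.ofReal x ^ (-s) *
            ENNReal.ofReal x ^ (d-1) := by
          conv_rhs => rw [← ENNReal.rpow_one (ENNReal.ofReal x), ← ENNReal.rpow_mul, 
            ← ENNReal.rpow_mul]
          rw [← ENNReal.rpow_add _ _ hx0 ENNReal.ofReal_ne_top,
            ← ENNReal.rpow_add _ _ hx0 ENNReal.ofReal_ne_top]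
          congr 1; ring
        rw [e]; ring
      · have hxu : x * u ∉ Ioi (0:ℝ) := by
          simp only [mem_Ioi, not_lt] at *; nlinarith
        have hu' : u ∉ Ioi (0:ℝ) := hu
        simp only [hF]
        rw [indicator_of_notMem hxu, indicator_of_notMem hu']; simp

noncomputable def fiS (x : ℝ) : ENNReal := ENNReal.ofReal (Real.sin (x/2))
noncomputable def fiT (x : ℝ) : ENNReal := ENNReal.ofReal (Real.cos (x/2))

theorem fiS_meas : Measurable fiS := by unfold fiS; fun_prop
theorem fiT_meas : Measurable fiT := by unfold fiT; fun_prop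
theorem fiS_le (x : ℝ) : fiS x ≤ 1 := by
  unfold fiS; rw [ENNReal.ofReal_le_one]; exact Real.sin_le_one _
theorem fiT_le (x : ℝ) : fiT x ≤ 1 := by
  unfold fiT; rw [ENNReal.ofReal_le_one]; exact Real.cos_le_one _
theorem fiS_pos {x : ℝ} (hx : x ∈ Ioo 0 π) : 0 < Real.sin (x/2) :=
  Real.sin_pos_of_pos_of_lt_pi (by linarith [hx.1]) (by linarith [hx.2, Real.pi_pos])
theorem fiT_pos {x : ℝ} (hx : x ∈ Ioo 0 π) : 0 < Real.cos (x/2) :=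
  Real.cos_pos_of_mem_Ioo ⟨by linarith [hx.1, Real.pi_pos], by linarith [hx.2]⟩
theorem fiS_ne {x : ℝ} (hx : x ∈ Ioo 0 π) : fiS x ≠ 0 := by
  have := fiS_pos hx; unfold fiS; simpa using this
theorem fiT_ne {x : ℝ} (hx : x ∈ Ioo 0 π) : fiT x ≠ 0 := by
  have := fiT_pos hx; unfold fiT; simpa using this
theorem fiS_top (x : ℝ) : fiS x ≠ ⊤ := ENNReal.ofReal_ne_top
theorem fiT_top (x : ℝ) : fiT x ≠ ⊤ := ENNReal.ofReal_ne_top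
theorem fiS_refl (x : ℝ) : fiS (π - x) = fiT x := by
  unfold fiS fiT; rw [show (π - x)/2 = π/2 - x/2 by ring, Real.sin_pi_div_two_sub]

theorem fi_half (s c d : ℝ) (hs0 : 0 < s) (hs1 : s < 1) (hc : 0 < c) (hd : 0 < d)
    (hcd : s ≤ c + d) : ∃ M : ENNReal, M ≠ ⊤ ∧ ∀ x ∈ Ioo (0:ℝ) π,
    ∫⁻ y in Ioo (0:ℝ) π, fiS x ^ c * ENNReal.ofReal |x - y| ^ (-s) * fiS y ^ (d - 1) ≤ M := by
  have hcd0 : 0 < c + d := by linarith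
  obtain ⟨c', d', hc', hd', hcc, hdd, hs⟩ : ∃ c' d' : ℝ, 0 < c' ∧ 0 < d' ∧ c' ≤ c ∧ d' ≤ d ∧
      c' + d' = s := by
    have hle : s / (c+d) ≤ 1 := by rw [div_le_one hcd0]; exact hcd
    refine ⟨c * (s/(c+d)), d * (s/(c+d)), by positivity, by positivity, ?_, ?_, ?_⟩
    · exact mul_le_of_le_one_right hc.le hle
    · exact mul_le_of_le_one_right hd.le hle
    · field_simp
  set J := ∫⁻ u in Ioi (0:ℝ), ENNReal.ofReal |1 - u| ^ (-s) * ENNReal.ofReal u ^ (d' - 1) with hJ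
  have hJt : J < ⊤ := fi_int_one s d' hs0 hs1 hd' (by linarith)
  set κ : ENNReal := ENNReal.ofReal (π⁻¹) ^ (d' - 1) with hκ
  have hpi0 : ENNReal.ofReal (π⁻¹) ≠ 0 := by simp [Real.pi_pos]
  have hκt : κ ≠ ⊤ := ENNReal.rpow_ne_top_of_ne_zero hpi0 ENNReal.ofReal_ne_top
  refine ⟨κ * J, ENNReal.mul_ne_top hκt hJt.ne, fun x hx => ?_⟩
  have hx0 : ENNReal.ofReal x ≠ 0 := by simpa using hx.1
  have b1 : fiS x ^ c ≤ ENNReal.ofReal x ^ c' := by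
    refine (ENNReal.rpow_le_rpow_of_exponent_ge (fiS_le x) hcc).trans ?_
    refine ENNReal.rpow_le_rpow (ENNReal.ofReal_le_ofReal ?_) hc'.le
    have := Real.sin_le (x := x/2) (by linarith [hx.1])
    linarith [hx.1]
  have b2 : ∀ y ∈ Ioo (0:ℝ) π, fiS y ^ (d-1) ≤ κ * ENNReal.ofReal y ^ (d' - 1) := by
    intro y hy
    refine (ENNReal.rpow_le_rpow_of_exponent_ge (fiS_le y)
      (by linarith : d' - 1 ≤ d - 1)).trans ?_
    rw [hκ, ← ENNReal.mul_rpow_of_ne_top ENNReal.ofReal_ne_top ENNReal.ofReal_ne_top,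
      ← ENNReal.ofReal_mul (by positivity)]
    rw [show d' - 1 = -(1 - d') by ring, ENNReal.rpow_neg, ENNReal.rpow_neg]
    refine ENNReal.inv_le_inv.2 (ENNReal.rpow_le_rpow (ENNReal.ofReal_le_ofReal ?_) (by linarith))
    have := Real.mul_le_sin (x := y/2) (by linarith [hy.1]) (by linarith [hy.2])
    calc π⁻¹ * y = 2/π * (y/2) := by field_simp
      _ ≤ _ := this
  calc ∫⁻ y in Ioo (0:ℝ) π, fiS x ^ c * ENNReal.ofReal |x - y| ^ (-s) * fiS y ^ (d - 1)
      ≤ ∫⁻ y in Ioo (0:ℝ) π, (κ * ENNReal.ofReal x ^ c') *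
        (ENNReal.ofReal |x - y| ^ (-s) * ENNReal.ofReal y ^ (d' - 1)) := by
        refine setLIntegral_mono' measurableSet_Ioo fun y hy => ?_
        calc _ ≤ ENNReal.ofReal x ^ c' * ENNReal.ofReal |x - y| ^ (-s) *
              (κ * ENNReal.ofReal y ^ (d' - 1)) := by
              gcongr
              exact b2 y hy
          _ = _ := by ring
    _ ≤ ∫⁻ y in Ioi (0:ℝ), (κ * ENNReal.ofReal x ^ c') *
        (ENNReal.ofReal |x - y| ^ (-s) * ENNReal.ofReal y ^ (d' - 1)) :=
        lintegral_mono_set Ioo_subset_Ioi_self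
    _ = κ * (ENNReal.ofReal x ^ c' * ENNReal.ofReal x ^ (d' - s)) * J := by
        rw [lintegral_const_mul _ (by fun_prop), fi_int_scale s d' hs0 x hx.1]
        ring
    _ = κ * J := by
        rw [← ENNReal.rpow_add _ _ hx0 ENNReal.ofReal_ne_top, show c' + (d' - s) = 0 by linarith]
        simp

theorem fi_refl (f : ℝ → ENNReal) :
    ∫⁻ y in Ioo (0:ℝ) π, f (π - y) = ∫⁻ y in Ioo (0:ℝ) π, f y := by
  rw [← lintegral_indicator measurableSet_Ioo, ← lintegral_indicator measurableSet_Ioo,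
    ← lintegral_sub_left_eq_self (fun y => (Ioo (0:ℝ) π).indicator (fun y => f y) y) π]
  refine lintegral_congr fun y => ?_
  by_cases hy : y ∈ Ioo (0:ℝ) π
  · have : π - y ∈ Ioo (0:ℝ) π := ⟨by linarith [hy.2], by linarith [hy.1]⟩
    rw [indicator_of_mem hy, indicator_of_mem this]
  · have : π - y ∉ Ioo (0:ℝ) π := fun h => hy ⟨by linarith [h.2], by linarith [h.1]⟩
    rw [indicator_of_notMem hy, indicator_of_notMem this]

theorem fi_trig (s c₁ c₂ d₁ d₂ : ℝ) (hs0 : 0 < s) (hs1 : s < 1) (hc₁ : 0 < c₁) (hd₁ : 0 < d₁)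
    (hc₂ : 0 < c₂) (hd₂ : 0 < d₂) (h₁ : s ≤ c₁ + d₁) (h₂ : s ≤ c₂ + d₂) :
    ∃ M : ENNReal, M ≠ ⊤ ∧ ∀ x ∈ Ioo (0:ℝ) π,
    ∫⁻ y in Ioo (0:ℝ) π, (fiS y * fiT y)⁻¹ * (fiS x ^ c₁ * fiT x ^ c₂ *
      ENNReal.ofReal |x - y| ^ (-s) * (fiS y ^ d₁ * fiT y ^ d₂)) ≤ M := by
  obtain ⟨M₁, hM₁, H₁⟩ := fi_half s c₁ d₁ hs0 hs1 hc₁ hd₁ h₁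
  obtain ⟨M₂, hM₂, H₂⟩ := fi_half s c₂ d₂ hs0 hs1 hc₂ hd₂ h₂
  refine ⟨M₁ + M₂, ENNReal.add_ne_top.2 ⟨hM₁, hM₂⟩, fun x hx => ?_⟩
  have H₂' : ∫⁻ y in Ioo (0:ℝ) π,
      fiT x ^ c₂ * ENNReal.ofReal |x - y| ^ (-s) * fiT y ^ (d₂ - 1) ≤ M₂ := by
    refine le_trans (le_of_eq ?_) (H₂ (π - x) ⟨by linarith [hx.2], by linarith [hx.1]⟩)
    rw [← fi_refl]
    refine lintegral_congr fun y => ?_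
    rw [fiS_refl, ← fiS_refl (π - y), show π - (π - y) = y by ring,
      show π - x - y = -(x - (π - y)) by ring, abs_neg]
  calc _ ≤ ∫⁻ y in Ioo (0:ℝ) π, (fiS x ^ c₁ * ENNReal.ofReal |x - y| ^ (-s) * fiS y ^ (d₁ - 1) +
      fiT x ^ c₂ * ENNReal.ofReal |x - y| ^ (-s) * fiT y ^ (d₂ - 1)) := by
        refine setLIntegral_mono' measurableSet_Ioo fun y hy => ?_
        have hS0 := fiS_ne hy
        have hT0 := fiT_ne hy
        have hSt := fiS_top y
        have hTt := fiT_top y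
        have one_le : 1 ≤ fiS y + fiT y := by
          have p1 := fiS_pos hy
          have p2 := fiT_pos hy
          unfold fiS fiT
          rw [← ENNReal.ofReal_add p1.le p2.le, ENNReal.one_le_ofReal]
          nlinarith [Real.sin_sq_add_cos_sq (y/2), Real.sin_le_one (y/2), Real.cos_le_one (y/2)]
        have inv_le : (fiS y * fiT y)⁻¹ ≤ (fiS y)⁻¹ + (fiT y)⁻¹ := by
          rw [ENNReal.mul_inv (Or.inl hS0) (Or.inl hSt)]
          calc (fiS y)⁻¹ * (fiT y)⁻¹ ≤ (fiS y)⁻¹ * (fiT y)⁻¹ * (fiS y + fiT y) :=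
                le_mul_of_one_le_right' one_le
            _ = (fiS y)⁻¹ * fiS y * (fiT y)⁻¹ + (fiT y)⁻¹ * fiT y * (fiS y)⁻¹ := by ring
            _ = _ := by
              rw [ENNReal.inv_mul_cancel hS0 hSt, ENNReal.inv_mul_cancel hT0 hTt]; ring
        have eS : fiS y ^ (d₁ - 1) = fiS y ^ d₁ * (fiS y)⁻¹ := by
          rw [sub_eq_add_neg, ENNReal.rpow_add _ _ hS0 hSt, ENNReal.rpow_neg_one]
        have eT : fiT y ^ (d₂ - 1) = fiT y ^ d₂ * (fiT y)⁻¹ := by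
          rw [sub_eq_add_neg, ENNReal.rpow_add _ _ hT0 hTt, ENNReal.rpow_neg_one]
        have l1 : fiT x ^ c₂ ≤ 1 := ENNReal.rpow_le_one (fiT_le x) hc₂.le
        have l2 : fiT y ^ d₂ ≤ 1 := ENNReal.rpow_le_one (fiT_le y) hd₂.le
        have l3 : fiS x ^ c₁ ≤ 1 := ENNReal.rpow_le_one (fiS_le x) hc₁.le
        have l4 : fiS y ^ d₁ ≤ 1 := ENNReal.rpow_le_one (fiS_le y) hd₁.le
        rw [eS, eT]
        set k := ENNReal.ofReal |x - y| ^ (-s)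
        calc _ ≤ ((fiS y)⁻¹ + (fiT y)⁻¹) *
              (fiS x ^ c₁ * fiT x ^ c₂ * k * (fiS y ^ d₁ * fiT y ^ d₂)) := by gcongr
          _ = fiS x ^ c₁ * k * (fiS y ^ d₁ * (fiS y)⁻¹) * (fiT x ^ c₂ * fiT y ^ d₂) +
              fiT x ^ c₂ * k * (fiT y ^ d₂ * (fiT y)⁻¹) * (fiS x ^ c₁ * fiS y ^ d₁) := by ring
          _ ≤ fiS x ^ c₁ * k * (fiS y ^ d₁ * (fiS y)⁻¹) * (1 * 1) +
              fiT x ^ c₂ * k * (fiT y ^ d₂ * (fiT y)⁻¹) * (1 * 1) := by gcongr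
          _ = _ := by simp
    _ = _ := lintegral_add_left (by have := fiS_meas; fun_prop) _
    _ ≤ M₁ + M₂ := add_le_add (H₁ x hx) H₂'

theorem fi_scalar (σ a b p q : ℝ) (hσ1 : σ < 1) (hp1 : 1 < p) (hpq : p ≤ q)
    (hσpq : 1/p - 1/q < σ)
    (ha1 : 0 < (a*(1-q/2)+1)/q) (hb1 : 0 < (b*(1-q/2)+1)/q)
    (ha2 : (a*(1-p/2)+1)/p < 1) (hb2 : (b*(1-p/2)+1)/p < 1)
    (ha3 : (a+1) * (1/p-1/q) ≤ σ) (hb3 : (b+1) * (1/p-1/q) ≤ σ) :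
    ∃ M : ENNReal, M ≠ ⊤ ∧ ∀ G : ℝ → ENNReal, Measurable G →
      (∫⁻ x in Ioo (0:ℝ) π, (∫⁻ y in Ioo (0:ℝ) π, G y * ENNReal.ofReal |x - y| ^ (σ-1)) ^ q *
        (fiS x ^ (a*(1-q/2)) * fiT x ^ (b*(1-q/2)))) ^ (1/q) ≤
      M * (∫⁻ y in Ioo (0:ℝ) π, G y ^ p * (fiS y ^ (a*(1-p/2)) * fiT y ^ (b*(1-p/2)))) ^ (1/p) := by
  have hp0 : 0 < p := by linarith
  have hq0 : 0 < q := by linarith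
  set c₁ := (a*(1-q/2)+1)/q with hc₁
  set c₂ := (b*(1-q/2)+1)/q with hc₂
  set e₁ := (a*(1-p/2)+1)/p with he₁
  set e₂ := (b*(1-p/2)+1)/p with he₂
  have hρ : 0 < 1 - 1/p + 1/q := by
    have : 1/p < 1 := by rw [div_lt_one hp0]; exact hp1
    have : 0 < 1/q := by positivity
    linarith
  obtain ⟨r, hr, hrr⟩ : ∃ r : ℝ, 0 < r ∧ 1/r = 1 - 1/p + 1/q :=
    ⟨1/(1 - 1/p + 1/q), by positivity, by rw [one_div_one_div]⟩
  have hs0 : 0 < (1-σ) * r := by have : 0 < 1 - σ := by linarith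
                                 positivity
  have hs1 : (1-σ) * r < 1 := by
    rw [← lt_div_iff₀ hr, hrr]; linarith
  have sumA : 1 - σ ≤ c₁ + (1 - e₁) := by
    have : c₁ + (1 - e₁) = 1 - (a+1) * (1/p-1/q) := by
      rw [hc₁, he₁]; field_simp; ring
    linarith
  have sumB : 1 - σ ≤ c₂ + (1 - e₂) := by
    have : c₂ + (1 - e₂) = 1 - (b+1) * (1/p-1/q) := by
      rw [hc₂, he₂]; field_simp; ring
    linarith
  have hd₁ : 0 < 1 - e₁ := by linarith
  have hd₂ : 0 < 1 - e₂ := by linarith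
  obtain ⟨M₁, hM₁, H₁⟩ := fi_trig ((1-σ)*r) (c₁*r) (c₂*r) ((1-e₁)*r) ((1-e₂)*r) hs0 hs1
    (by positivity) (by positivity) (by positivity) (by positivity) (by nlinarith) (by nlinarith)
  obtain ⟨M₂, hM₂, H₂⟩ := fi_trig ((1-σ)*r) ((1-e₁)*r) ((1-e₂)*r) (c₁*r) (c₂*r) hs0 hs1
    (by positivity) (by positivity) (by positivity) (by positivity) (by nlinarith) (by nlinarith)
  refine ⟨(M₁ + M₂) ^ (1/r), ENNReal.rpow_ne_top_of_nonneg (by positivity)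
    (ENNReal.add_ne_top.2 ⟨hM₁, hM₂⟩), fun G hG => ?_⟩
  have mS := fiS_meas
  have mT := fiT_meas
  set D : ℝ → ENNReal := fun y => (fiS y * fiT y)⁻¹ with hD
  have mD : Measurable D := by fun_prop
  set μ := (volume.restrict (Ioo (0:ℝ) π)).withDensity D with hμ
  have hint : ∀ F : ℝ → ENNReal, Measurable F → ∫⁻ y, F y ∂μ = ∫⁻ y in Ioo (0:ℝ) π, D y * F y := by
    intro F hF
    rw [hμ, lintegral_withDensity_eq_lintegral_mul _ mD hF]; rfl
  have hae : ∀ᵐ x ∂μ, x ∈ Ioo (0:ℝ) π :=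
    (withDensity_absolutelyContinuous _ _).ae_le (ae_restrict_mem measurableSet_Ioo)
  set K : ℝ → ℝ → ENNReal := fun x y => fiS x ^ c₁ * fiT x ^ c₂ *
      ENNReal.ofReal |x - y| ^ (σ-1) * (fiS y ^ (1-e₁) * fiT y ^ (1-e₂)) with hKdef
  have mK : Measurable (Function.uncurry K) := by
    simp only [hKdef, Function.uncurry_def]; fun_prop
  have mKx : ∀ x, Measurable (K x) := fun x => mK.of_uncurry_left
  have mKy : ∀ y, Measurable (fun x => K x y) := fun y => mK.of_uncurry_right
  set f : ℝ → ENNReal := fun y => G y * (fiS y ^ e₁ * fiT y ^ e₂) with hf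
  have mf : Measurable f := by fun_prop
  have Kr : ∀ x y, K x y ^ r = fiS x ^ (c₁*r) * fiT x ^ (c₂*r) *
      ENNReal.ofReal |x - y| ^ (-((1-σ)*r)) * (fiS y ^ ((1-e₁)*r) * fiT y ^ ((1-e₂)*r)) := by
    intro x y
    simp only [hKdef]
    rw [ENNReal.mul_rpow_of_nonneg _ _ hr.le, ENNReal.mul_rpow_of_nonneg _ _ hr.le,
      ENNReal.mul_rpow_of_nonneg _ _ hr.le, ENNReal.mul_rpow_of_nonneg _ _ hr.le]
    simp only [← ENNReal.rpow_mul]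
    rw [show (σ-1)*r = -((1-σ)*r) by ring]
  have S := fi_schur μ K mK f mf p q r hp1 hpq hr hrr (M₁ + M₂)
    (by
      filter_upwards [hae] with x hx
      rw [hint _ ((mKx x).pow_const r)]
      simp only [Kr]
      exact (H₁ x hx).trans le_self_add)
    (by
      filter_upwards [hae] with y hy
      rw [hint _ ((mKy y).pow_const r)]
      refine le_trans (le_of_eq ?_) ((H₂ y hy).trans le_add_self)
      refine lintegral_congr fun x => ?_
      rw [Kr, abs_sub_comm]; ring)
  have mKf : Measurable fun x => ∫⁻ y, K x y * f y ∂μ :=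
    Measurable.lintegral_prod_right' (f := fun z : ℝ × ℝ => K z.1 z.2 * f z.2)
      (mK.mul (mf.comp measurable_snd))
  rw [hint _ (mKf.pow_const q), hint _ (mf.pow_const p)] at S
  refine le_trans (le_of_eq ?_) (S.trans (le_of_eq ?_))
  · congr 1
    refine setLIntegral_congr_fun measurableSet_Ioo fun x hx => ?_
    have hS0 := fiS_ne hx
    have hT0 := fiT_ne hx
    have hSt := fiS_top x
    have hTt := fiT_top x
    have inner : ∫⁻ y, K x y * f y ∂μ = (fiS x ^ c₁ * fiT x ^ c₂) *
        ∫⁻ y in Ioo (0:ℝ) π, G y * ENNReal.ofReal |x - y| ^ (σ-1) := by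
      have hm : Measurable fun y => K x y * f y := (mKx x).mul mf
      rw [hint _ hm, ← lintegral_const_mul _ (by fun_prop)]
      refine setLIntegral_congr_fun measurableSet_Ioo fun y hy => ?_
      have uS : fiS y ^ (1-e₁) * fiS y ^ e₁ = fiS y := by
        rw [← ENNReal.rpow_add _ _ (fiS_ne hy) (fiS_top y)]; simp
      have uT : fiT y ^ (1-e₂) * fiT y ^ e₂ = fiT y := by
        rw [← ENNReal.rpow_add _ _ (fiT_ne hy) (fiT_top y)]; simp
      simp only [hKdef, hf, hD]
      calc _ = (fiS y * fiT y)⁻¹ * ((fiS y ^ (1-e₁) * fiS y ^ e₁) * (fiT y ^ (1-e₂) * fiT y ^ e₂))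
            * (fiS x ^ c₁ * fiT x ^ c₂ * (G y * ENNReal.ofReal |x - y| ^ (σ-1))) := by ring
        _ = _ := by
          rw [uS, uT, ENNReal.inv_mul_cancel (mul_ne_zero (fiS_ne hy) (fiT_ne hy))
            (ENNReal.mul_ne_top (fiS_top y) (fiT_top y)), one_mul]
    simp only [inner]
    rw [ENNReal.mul_rpow_of_nonneg _ _ hq0.le, ENNReal.mul_rpow_of_nonneg _ _ hq0.le,
      ← ENNReal.rpow_mul, ← ENNReal.rpow_mul, hc₁, hc₂, div_mul_cancel₀ _ hq0.ne',
      div_mul_cancel₀ _ hq0.ne', ENNReal.rpow_add _ _ hS0 hSt, ENNReal.rpow_add _ _ hT0 hTt,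
      ENNReal.rpow_one, ENNReal.rpow_one]
    simp only [hD]
    set I := ∫⁻ y in Ioo (0:ℝ) π, G y * ENNReal.ofReal |x - y| ^ (σ-1)
    calc _ = 1 * (I ^ q * (fiS x ^ (a*(1-q/2)) * fiT x ^ (b*(1-q/2)))) := by rw [one_mul]
      _ = ((fiS x * fiT x)⁻¹ * (fiS x * fiT x)) *
            (I ^ q * (fiS x ^ (a*(1-q/2)) * fiT x ^ (b*(1-q/2)))) := by
          rw [ENNReal.inv_mul_cancel (mul_ne_zero hS0 hT0) (ENNReal.mul_ne_top hSt hTt)]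
      _ = _ := by ring
  · congr 2
    refine setLIntegral_congr_fun measurableSet_Ioo fun x hx => ?_
    have hS0 := fiS_ne hx
    have hT0 := fiT_ne hx
    have hSt := fiS_top x
    have hTt := fiT_top x
    simp only [hf]
    rw [ENNReal.mul_rpow_of_nonneg _ _ hp0.le, ENNReal.mul_rpow_of_nonneg _ _ hp0.le,
      ← ENNReal.rpow_mul, ← ENNReal.rpow_mul, he₁, he₂, div_mul_cancel₀ _ hp0.ne',
      div_mul_cancel₀ _ hp0.ne', ENNReal.rpow_add _ _ hS0 hSt, ENNReal.rpow_add _ _ hT0 hTt,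
      ENNReal.rpow_one, ENNReal.rpow_one]
    simp only [hD]
    symm
    calc _ = 1 * (G x ^ p * (fiS x ^ (a*(1-p/2)) * fiT x ^ (b*(1-p/2)))) := by rw [one_mul]
      _ = ((fiS x * fiT x)⁻¹ * (fiS x * fiT x)) *
            (G x ^ p * (fiS x ^ (a*(1-p/2)) * fiT x ^ (b*(1-p/2)))) := by
          rw [ENNReal.inv_mul_cancel (mul_ne_zero hS0 hT0) (ENNReal.mul_ne_top hSt hTt)]
      _ = _ := by ring

/-- The parameter conditions at one endpoint, with `a = 2α+1`. -/
theorem fi_params (σ α p q : ℝ) (hσ0 : 0 < σ) (hα : -(1/2) ≤ α)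
    (hp : (2*α+2)/(α+3/2) < p) (hpq : p ≤ q) (hq : q < (2*α+2)/(α+1/2))
    (h : 1/q ≥ 1/p - σ/(2*α+2)) :
    1 < p ∧ 1/p - 1/q < σ ∧ 0 < ((2*α+1)*(1-q/2)+1)/q ∧ ((2*α+1)*(1-p/2)+1)/p < 1 ∧
      ((2*α+1)+1) * (1/p-1/q) ≤ σ := by
  have h32 : 0 < α + 3/2 := by linarith
  have hp1 : 1 < p := by
    refine lt_of_le_of_lt ?_ hp
    rw [le_div_iff₀ h32]; linarith
  have hp0 : 0 < p := by linarith
  have hq0 : 0 < q := by linarith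
  have h12 : 0 < α + 1/2 := by
    rcases hα.lt_or_eq with h | h
    · linarith
    · exfalso
      rw [← h] at hq
      norm_num at hq
      linarith
  have h2 : 0 < 2*α+2 := by linarith
  rw [div_lt_iff₀ h32] at hp
  rw [lt_div_iff₀ h12] at hq
  have last : ((2*α+1)+1) * (1/p-1/q) ≤ σ := by
    have : 1/p - 1/q ≤ σ/(2*α+2) := by linarith
    rw [le_div_iff₀ h2] at this
    linarith
  have hnn : 0 ≤ 1/p - 1/q := by
    have := one_div_le_one_div_of_le hp0 hpq
    linarith
  refine ⟨hp1, ?_, ?_, ?_, last⟩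
  · rcases hnn.lt_or_eq with h | h
    · nlinarith
    · rw [← h]; exact hσ0
  · apply div_pos _ hq0
    nlinarith
  · rw [div_lt_one hp0]
    nlinarith

/-- Vector-valued (square function) weighted `L^p → L^q` inequality for the fractional
integral `I_σ` on `(0,π)` with the power weights
`w(θ) = (sin(θ/2))^{(2α+1)(1-q/2)}(cos(θ/2))^{(2β+1)(1-q/2)}` and
`v(θ) = (sin(θ/2))^{(2α+1)(1-p/2)}(cos(θ/2))^{(2β+1)(1-p/2)}`. -/
theorem fracIntegral_weighted_vector_valued (σ α β p q : ℝ) (hσ0 : 0 < σ) (hσ1 : σ < 1)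
    (hα : -(1/2) ≤ α) (hβ : -(1/2) ≤ β)
    (hp : max ((2*α+2)/(α+3/2)) ((2*β+2)/(β+3/2)) < p) (hpq : p ≤ q)
    (hq : q < min ((2*α+2)/(α+1/2)) ((2*β+2)/(β+1/2)))
    (hσpq : 1/q ≥ 1/p - min (σ/(2*α+2)) (σ/(2*β+2))) :
    ∃ C : ℝ, 0 < C ∧ ∀ g : ℕ → ℝ → ℝ, (∀ j, Measurable (g j)) → (∀ j θ, 0 ≤ g j θ) →
      (∫⁻ θ in Ioo (0:ℝ) π, (∑' j : ℕ, fracIntegral σ (g j) θ ^ (2:ℝ)) ^ (q/2) *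
          ENNReal.ofReal ((Real.sin (θ/2)) ^ ((2*α+1)*(1 - q/2)) *
            (Real.cos (θ/2)) ^ ((2*β+1)*(1 - q/2)))) ^ (1/q) ≤
        ENNReal.ofReal C *
          (∫⁻ θ in Ioo (0:ℝ) π, (∑' j : ℕ, ENNReal.ofReal (g j θ) ^ (2:ℝ)) ^ (p/2) *
            ENNReal.ofReal ((Real.sin (θ/2)) ^ ((2*α+1)*(1 - p/2)) *
              (Real.cos (θ/2)) ^ ((2*β+1)*(1 - p/2)))) ^ (1/p) := by
  obtain ⟨hpa, hpb⟩ := max_lt_iff.1 hp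
  obtain ⟨hqa, hqb⟩ := lt_min_iff.1 hq
  obtain ⟨hp1, hs, ha1, ha2, ha3⟩ := fi_params σ α p q hσ0 hα hpa hpq hqa
    (by have := min_le_left (σ/(2*α+2)) (σ/(2*β+2)); linarith)
  obtain ⟨-, -, hb1, hb2, hb3⟩ := fi_params σ β p q hσ0 hβ hpb hpq hqb
    (by have := min_le_right (σ/(2*α+2)) (σ/(2*β+2)); linarith)
  have hp0 : 0 < p := by linarith
  have hq0 : 0 < q := by linarith
  obtain ⟨M, hM, H⟩ := fi_scalar σ (2*α+1) (2*β+1) p q hσ1 hp1 hpq hs ha1 hb1 ha2 hb2 ha3 hb3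
  have hwt : ∀ u v : ℝ, ∀ x ∈ Ioo (0:ℝ) π,
      ENNReal.ofReal ((Real.sin (x/2)) ^ u * (Real.cos (x/2)) ^ v) = fiS x ^ u * fiT x ^ v := by
    intro u v x hx
    have h1 := fiS_pos hx
    have h2 := fiT_pos hx
    unfold fiS fiT
    rw [ENNReal.ofReal_mul (by positivity), ENNReal.ofReal_rpow_of_pos h1,
      ENNReal.ofReal_rpow_of_pos h2]
  refine ⟨M.toReal + 1, by positivity, fun g hg hg0 => ?_⟩
  set G : ℝ → ENNReal := fun y => (∑' j, ENNReal.ofReal (g j y) ^ (2:ℝ)) ^ (1/2:ℝ) with hG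
  have mG : Measurable G :=
    (Measurable.tsum fun j => (hg j).ennreal_ofReal.pow_const _).pow_const _
  have hMle : M ≤ ENNReal.ofReal (M.toReal + 1) := by
    conv_lhs => rw [← ENNReal.ofReal_toReal hM]
    exact ENNReal.ofReal_le_ofReal (by linarith)
  refine le_trans ?_ ((H G mG).trans (mul_le_mul' hMle (le_of_eq ?_)))
  · refine ENNReal.rpow_le_rpow (setLIntegral_mono' measurableSet_Ioo fun x hx => ?_)
      (by positivity)
    rw [hwt _ _ x hx]
    gcongr
    have := fi_minkowski (volume.restrict (Ioo (0:ℝ) π))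
      (fun y => ENNReal.ofReal |x - y| ^ (σ - 1)) (by fun_prop)
      (fun j y => ENNReal.ofReal (g j y)) (fun j => (hg j).ennreal_ofReal)
    calc _ ≤ ((∫⁻ y in Ioo (0:ℝ) π, G y * ENNReal.ofReal |x - y| ^ (σ-1)) ^ (2:ℝ)) ^ (q/2) :=
          ENNReal.rpow_le_rpow this (by positivity)
      _ = _ := by rw [← ENNReal.rpow_mul, mul_div_cancel₀ q two_ne_zero]
  · congr 1
    refine setLIntegral_congr_fun measurableSet_Ioo fun x hx => ?_
    simp only [hG]
    rw [hwt _ _ x hx, ← ENNReal.rpow_mul]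
    congr 2; ring
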